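/- For every n ≥ 1, the set of symmetric wheel polynomials of order n — wheel polynomials in ℂ[z_1,…,z_{2n}] invariant under every permutation of the variables z_1,…,z_{2n} — is a ℂ-linear subspace of dimension exactly 1. In particular, there exists a nonzero symmetric wheel polynomial of order n, and any two symmetric wheel polynomials of order n are linearly dependent. -/

import Mathlib

open scoped BigOperators

open MvPolynomial

attribute [local instance 10] Classical.propDecidable

/-- A noncrossing matching of order `n`, on the points `0, …, 2n-1`
(representing the 1-indexed points `1, …, 2n`): a fixed-point-free involution
with no crossing `a < b < c < d`, `f a = c`, `f b = d`. -/
structure NCM (n : ℕ) where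
  f : Fin (2 * n) → Fin (2 * n)
  invol : ∀ k, f (f k) = k
  nofix : ∀ k, f k ≠ k
  noncross : ∀ a b c d : Fin (2 * n), a < b → b < c → c < d → f a = c → f b = d → False

theorem NCM.ext' {n : ℕ} {π σ : NCM n} (h : π.f = σ.f) : π = σ := by
  cases π; cases σ; simpa using h

noncomputable instance {n : ℕ} : Fintype (NCM n) :=
  Fintype.ofInjective NCM.f fun _ _ h => NCM.ext' h

/-- `q = e^{2πi/3}`. -/
noncomputable def q : ℂ := Complex.exp (2 * Real.pi * Complex.I / 3)

/-- A wheel polynomial of order `n`: homogeneous of total degree `n(n-1)` and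
vanishing under every substitution `z_j := q² z_i`, `z_k := q⁴ z_i` for `i < j < k`. -/
def IsWheel (n : ℕ) (p : MvPolynomial (Fin (2 * n)) ℂ) : Prop :=
  p.IsHomogeneous (n * (n - 1)) ∧
  ∀ i j k : Fin (2 * n), i < j → j < k →
    (aeval fun l : Fin (2 * n) =>
      if l = j then C (q ^ 2) * X i
      else if l = k then C (q ^ 4) * X i
      else (X l : MvPolynomial (Fin (2 * n)) ℂ)) p = 0

/-- The `π`-evaluation `p(π) = p(q^{-π_1}, …, q^{-π_{2n}})`, where the `k`-th coordinate
is `q⁻¹` if `π` matches `k` to the right and `q` if it matches `k` to the left. -/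
noncomputable def evalNC {n : ℕ} (p : MvPolynomial (Fin (2 * n)) ℂ) (π : NCM n) : ℂ :=
  eval (fun k => if k < π.f k then q⁻¹ else q) p

/-- Evaluation of a polynomial with all variables set to `1`. -/
noncomputable def evalOne {n : ℕ} (p : MvPolynomial (Fin (2 * n)) ℂ) : ℂ :=
  eval (fun _ => (1 : ℂ)) p

/-- The alternating sign matrix numbers `ASM(n) = ∏_{j=0}^{n-1} (3j+1)!/(n+j)!`. -/
noncomputable def ASM (n : ℕ) : ℂ :=
  ∏ j ∈ Finset.range n, ((3 * j + 1).factorial : ℂ) / ((n + j).factorial : ℂ)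

/-- Cyclic successor on `Fin m`. -/
def fsucc {m : ℕ} (k : Fin m) : Fin m := ⟨((k : ℕ) + 1) % m, Nat.mod_lt _ k.pos⟩

/-- The Temperley–Lieb operator `e_k` (underlying function on points): if `π` matches
`k` with `k+1` it is `π`; otherwise it matches `k ↔ k+1`, `π(k) ↔ π(k+1)` and agrees
with `π` elsewhere (indices cyclic modulo `2n`). -/
def eRaw {n : ℕ} (k : Fin (2 * n)) (π : NCM n) : Fin (2 * n) → Fin (2 * n) :=
  if π.f k = fsucc k then π.f
  else fun m =>
    if m = k then fsucc k
    else if m = fsucc k then k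
    else if m = π.f k then π.f (fsucc k)
    else if m = π.f (fsucc k) then π.f k
    else π.f m

/-- The stationarity linear system `2n·v_π = Σ_{k=1}^{2n} Σ_{π' : e_k(π') = π} v_{π'}`. -/
def Stationary {n : ℕ} (v : NCM n → ℂ) : Prop :=
  ∀ π : NCM n, ((2 * n : ℕ) : ℂ) * v π =
    ∑ k : Fin (2 * n), ∑ π' : NCM n, if eRaw k π' = π.f then v π' else 0

/-! ### Linear factors -/

theorem q_cube : q ^ 3 = 1 := by
  unfold q
  rw [← Complex.exp_nat_mul]
  rw [show ((3 : ℕ) : ℂ) * (2 * Real.pi * Complex.I / 3) = 2 * Real.pi * Complex.I by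
    push_cast; ring]
  exact Complex.exp_two_pi_mul_I

theorem q_prim : IsPrimitiveRoot q 3 := by
  have := Complex.isPrimitiveRoot_exp 3 (by norm_num)
  simpa [q] using this

theorem q_ne_one : q ≠ 1 := q_prim.ne_one (by norm_num)

theorem q_ne_zero : q ≠ 0 := q_prim.ne_zero (by norm_num)

theorem q_sum : 1 + q + q ^ 2 = 0 := by
  have h : (q - 1) * (1 + q + q ^ 2) = 0 := by
    have := q_cube
    linear_combination this
  rcases mul_eq_zero.1 h with h | h
  · exact absurd (sub_eq_zero.1 h) q_ne_one
  · exact h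

theorem q_sq_ne_one : q ^ 2 ≠ 1 := by
  intro h
  apply q_ne_one
  have := q_cube
  have h3 : q ^ 3 = q ^ 2 * q := by ring
  rw [h3, h, one_mul] at this
  exact this

theorem q_four : q ^ 4 = q := by
  have := q_cube
  linear_combination q * this

/-- The linear form `z_i - c z_j`. -/
noncomputable def lin {N : ℕ} (c : ℂ) (i j : Fin N) : MvPolynomial (Fin N) ℂ :=
  X i - C c * X j

theorem lin_homog {N : ℕ} (c : ℂ) (i j : Fin N) : (lin c i j).IsHomogeneous 1 :=
  (isHomogeneous_X _ _).sub (isHomogeneous_C_mul_X _ _)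

theorem eval_lin {N : ℕ} (c : ℂ) (i j : Fin N) (x : Fin N → ℂ) :
    eval x (lin c i j) = x i - c * x j := by
  simp [lin]

theorem lin_ne_zero {N : ℕ} (c : ℂ) {i j : Fin N} (h : i ≠ j) : lin c i j ≠ 0 := by
  intro h0
  have := eval_lin c i j (Pi.single i 1)
  rw [h0] at this
  simp [h.symm] at this

/-- Substitution `z_i := c z_j`. -/
noncomputable def sub1 {N : ℕ} (c : ℂ) (i j : Fin N) :
    MvPolynomial (Fin N) ℂ →ₐ[ℂ] MvPolynomial (Fin N) ℂ :=
  aeval (Function.update X i (C c * X j))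

theorem lin_dvd_sub {N : ℕ} (c : ℂ) (i j : Fin N) (f : MvPolynomial (Fin N) ℂ) :
    lin c i j ∣ f - sub1 c i j f := by
  induction f using MvPolynomial.induction_on with
  | C a => simp [sub1]
  | add p r hp hr =>
    rw [map_add]
    have := dvd_add hp hr
    convert this using 1
    ring
  | mul_X p k hp =>
    have hk : lin c i j ∣ X k - sub1 c i j (X k) := by
      by_cases h : k = i
      · subst h; simp [sub1, lin]
      · simp [sub1, h]
    rw [map_mul]
    have := dvd_add (hp.mul_right (X k)) (hk.mul_left (sub1 c i j p))
    convert this using 1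
    ring

theorem sub1_lin {N : ℕ} (c : ℂ) {i j : Fin N} (h : i ≠ j) : sub1 c i j (lin c i j) = 0 := by
  simp [sub1, lin, h.symm]

theorem lin_dvd_iff {N : ℕ} (c : ℂ) {i j : Fin N} (h : i ≠ j) (f : MvPolynomial (Fin N) ℂ) :
    lin c i j ∣ f ↔ ∀ x : Fin N → ℂ, x i = c * x j → eval x f = 0 := by
  constructor
  · rintro ⟨g, rfl⟩ x hx
    rw [map_mul, eval_lin, hx]; simp
  · intro hx
    have h0 : sub1 c i j f = 0 := by
      apply MvPolynomial.funext
      intro x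
      have : eval x (sub1 c i j f) = eval (Function.update x i (c * x j)) f := by
        unfold sub1
        rw [← MvPolynomial.coe_aeval_eq_eval, ← MvPolynomial.coe_aeval_eq_eval]
        simp only [RingHom.coe_coe]
        rw [← AlgHom.comp_apply, MvPolynomial.comp_aeval]
        congr 1
        congr 1
        funext l
        by_cases hl : l = i
        · subst hl; simp
        · simp [hl]
      rw [this, map_zero]
      apply hx
      simp [h.symm]
    have := lin_dvd_sub c i j f
    rwa [h0, sub_zero] at this

theorem lin_prime {N : ℕ} (c : ℂ) {i j : Fin N} (h : i ≠ j) : Prime (lin c i j) := by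
  have key : ∀ f, lin c i j ∣ f ↔ sub1 c i j f = 0 := by
    intro f
    constructor
    · rintro ⟨g, rfl⟩
      rw [map_mul, sub1_lin c h, zero_mul]
    · intro h0
      have := lin_dvd_sub c i j f
      rwa [h0, sub_zero] at this
  refine ⟨lin_ne_zero c h, ?_, ?_⟩
  · intro hu
    have := (key 1).1 hu.dvd
    simp at this
  · intro a b hab
    rw [key, map_mul] at hab
    rw [key, key]
    exact mul_eq_zero.1 hab

/-- Two linear forms are relatively prime if some point kills the first but not the second. -/
theorem lin_relPrime {N : ℕ} (c d : ℂ) {i j k l : Fin N} (h : i ≠ j) (_h' : k ≠ l)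
    (x : Fin N → ℂ) (hx : x i = c * x j) (hx' : x k ≠ d * x l) :
    IsRelPrime (lin c i j) (lin d k l) := by
  rw [(lin_prime c h).irreducible.isRelPrime_iff_not_dvd]
  intro hd
  have := (lin_dvd_iff c h _).1 hd x hx
  rw [eval_lin] at this
  exact hx' (sub_eq_zero.1 this)

/-! ### Symmetric wheel polynomials, in terms of evaluations -/

/-- Symmetric polynomial with the wheel condition, phrased with evaluations. -/
def SW {N : ℕ} (p : MvPolynomial (Fin N) ℂ) : Prop :=
  (∀ (s : Equiv.Perm (Fin N)) (x : Fin N → ℂ), eval (x ∘ s) p = eval x p) ∧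
  (∀ (x : Fin N → ℂ) (i j k : Fin N), i ≠ j → j ≠ k → i ≠ k →
    x j = q ^ 2 * x i → x k = q * x i → eval x p = 0)

theorem SW.comb {N : ℕ} {p r : MvPolynomial (Fin N) ℂ} (hp : SW p) (hr : SW r) (a b : ℂ) :
    SW (C a * p + C b * r) := by
  constructor
  · intro s x
    simp [hp.1 s x, hr.1 s x]
  · intro x i j k h1 h2 h3 h4 h5
    simp [hp.2 x i j k h1 h2 h3 h4 h5, hr.2 x i j k h1 h2 h3 h4 h5]

/-- The substitution `z_1 := q² z_0`. -/
noncomputable def phi (m : ℕ) :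
    MvPolynomial (Fin (m + 2)) ℂ →ₐ[ℂ] MvPolynomial (Fin (m + 1)) ℂ :=
  aeval (Fin.cons (X 0) (Fin.cons (C (q ^ 2) * X 0) (fun s : Fin m => X s.succ)))

theorem eval_phi (m : ℕ) (p : MvPolynomial (Fin (m + 2)) ℂ) (t : ℂ) (x : Fin m → ℂ) :
    eval (Fin.cons t x : Fin (m + 1) → ℂ) (phi m p) =
      eval (Fin.cons t (Fin.cons (q ^ 2 * t) x) : Fin (m + 2) → ℂ) p := by
  unfold phi
  rw [← MvPolynomial.coe_aeval_eq_eval, ← MvPolynomial.coe_aeval_eq_eval]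
  simp only [RingHom.coe_coe]
  rw [← AlgHom.comp_apply, MvPolynomial.comp_aeval]
  congr 1
  congr 1
  funext l
  refine Fin.cases ?_ (fun l => ?_) l
  · simp
  · refine Fin.cases ?_ (fun l => ?_) l
    · simp
    · simp

theorem phi_totalDegree (m : ℕ) (p : MvPolynomial (Fin (m + 2)) ℂ) :
    (phi m p).totalDegree ≤ p.totalDegree := by
  conv_lhs => rw [← MvPolynomial.sum_homogeneousComponent p]
  rw [map_sum]
  refine (totalDegree_finsetSum _ _).trans ?_
  apply Finset.sup_le
  intro d hd
  have h1 : (phi m (homogeneousComponent d p)).IsHomogeneous (1 * d) := by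
    apply (homogeneousComponent_isHomogeneous d p).aeval
    intro l
    refine Fin.cases ?_ (fun l => ?_) l
    · rw [Fin.cons_zero]
      exact isHomogeneous_X _ _
    · rw [Fin.cons_succ]
      refine Fin.cases ?_ (fun l => ?_) l
      · rw [Fin.cons_zero]
        exact isHomogeneous_C_mul_X (q ^ 2) (0 : Fin (m + 1))
      · rw [Fin.cons_succ]
        exact isHomogeneous_X _ _
  have := h1.totalDegree_le
  have h2 := Finset.mem_range.1 hd
  omega

/-- The universal factor. -/
noncomputable def bigPi (m : ℕ) : MvPolynomial (Fin (m + 1)) ℂ :=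
  ∏ s : Fin m, lin q s.succ 0

theorem bigPi_homog (m : ℕ) : (bigPi m).IsHomogeneous m := by
  have := IsHomogeneous.prod Finset.univ (fun s : Fin m => lin q s.succ 0) (fun _ => 1)
    (fun s _ => lin_homog _ _ _)
  simpa [bigPi] using this

theorem bigPi_ne_zero (m : ℕ) : bigPi m ≠ 0 := by
  unfold bigPi
  rw [Finset.prod_ne_zero_iff]
  intro s _
  exact lin_ne_zero _ (Fin.succ_ne_zero s)

theorem phi_factor {m : ℕ} {p : MvPolynomial (Fin (m + 2)) ℂ} (hp : SW p) :
    bigPi m ∣ phi m p := by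
  unfold bigPi
  apply Fintype.prod_dvd_of_isRelPrime
  · intro s t hst
    apply lin_relPrime q q (Fin.succ_ne_zero s) (Fin.succ_ne_zero t) (Pi.single t.succ 1)
    · simp [hst]
    · simp
  · intro s
    rw [lin_dvd_iff _ (Fin.succ_ne_zero s)]
    intro x hx
    have : x = Fin.cons (x 0) (fun l : Fin m => x l.succ) := by
      exact (Fin.cons_self_tail x).symm
    rw [this, eval_phi]
    apply hp.2 _ 0 1 s.succ.succ
    · simp
    · intro h
      have := congrArg Fin.val h
      simp at this
    · exact (Fin.succ_ne_zero _).symm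
    · rfl
    · simpa using hx

/-- If the identity of evaluations holds away from the zeros of the factor,
then it holds for coefficients. -/
theorem coeff_eq_of_generic {m : ℕ} (r : MvPolynomial (Fin (m + 1)) ℂ) (x y : Fin m → ℂ) (a : ℂ)
    (h : ∀ t : ℂ, (∀ s, x s - q * t ≠ 0) →
      eval (Fin.cons t x : Fin (m + 1) → ℂ) r = a * eval (Fin.cons t y : Fin (m + 1) → ℂ) r)
    (k : ℕ) :
    eval x ((finSuccEquiv ℂ m r).coeff k) = a * eval y ((finSuccEquiv ℂ m r).coeff k) := by
  have h0 : Polynomial.map (eval x) (finSuccEquiv ℂ m r)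
      - Polynomial.C a * Polynomial.map (eval y) (finSuccEquiv ℂ m r) = 0 := by
    apply Polynomial.eq_zero_of_infinite_isRoot
    have hfin : (Set.range fun s => q⁻¹ * x s).Finite := Set.finite_range _
    apply hfin.infinite_compl.mono
    intro t ht
    have h1 := h t (by
      intro s hs
      apply ht
      refine ⟨s, ?_⟩
      have : x s = q * t := sub_eq_zero.1 hs
      simp only [this]
      rw [← mul_assoc, inv_mul_cancel₀ q_ne_zero, one_mul])
    rw [eval_eq_eval_mv_eval', eval_eq_eval_mv_eval'] at h1
    simp [Polynomial.IsRoot, h1]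
  have := congrArg (fun P => Polynomial.coeff P k) h0
  simp only [Polynomial.coeff_sub, Polynomial.coeff_C_mul, Polynomial.coeff_map,
    Polynomial.coeff_zero] at this
  exact sub_eq_zero.1 this

theorem eval_bigPi (m : ℕ) (t : ℂ) (x : Fin m → ℂ) :
    eval (Fin.cons t x : Fin (m + 1) → ℂ) (bigPi m) = ∏ s, (x s - q * t) := by
  simp [bigPi, map_prod, eval_lin]

theorem eval_factor {m : ℕ} {p : MvPolynomial (Fin (m + 2)) ℂ}
    {r : MvPolynomial (Fin (m + 1)) ℂ} (hr : phi m p = bigPi m * r) (t : ℂ) (x : Fin m → ℂ) :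
    eval (Fin.cons t (Fin.cons (q ^ 2 * t) x) : Fin (m + 2) → ℂ) p =
      (∏ s, (x s - q * t)) * eval (Fin.cons t x : Fin (m + 1) → ℂ) r := by
  rw [← eval_phi, hr, map_mul, eval_bigPi]

/-- Extend a permutation by fixing the first two points. -/
theorem exists_perm_extend {m : ℕ} (s : Equiv.Perm (Fin m)) :
    ∃ s' : Equiv.Perm (Fin (m + 2)), ∀ (a b : ℂ) (x : Fin m → ℂ),
      (Fin.cons a (Fin.cons b x) : Fin (m + 2) → ℂ) ∘ s' = Fin.cons a (Fin.cons b (x ∘ s)) := by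
  refine ⟨Equiv.Perm.decomposeFin.symm (0, Equiv.Perm.decomposeFin.symm (0, s)), ?_⟩
  intro a b x
  funext l
  refine Fin.cases ?_ (fun l => ?_) l
  · simp
  · refine Fin.cases ?_ (fun l => ?_) l
    · simp
    · simp

theorem coeff_SW {m : ℕ} {p : MvPolynomial (Fin (m + 2)) ℂ} (hp : SW p)
    {r : MvPolynomial (Fin (m + 1)) ℂ} (hr : phi m p = bigPi m * r) (k : ℕ) :
    SW ((finSuccEquiv ℂ m r).coeff k) := by
  constructor
  · intro s x
    have := coeff_eq_of_generic r (x ∘ s) x 1 ?_ k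
    · simpa using this
    · intro t ht
      have hne : ∏ l, ((x ∘ s) l - q * t) ≠ 0 := Finset.prod_ne_zero_iff.2 fun l _ => ht l
      have h1 := eval_factor hr t (x ∘ s)
      have h2 := eval_factor hr t x
      obtain ⟨s', hs'⟩ := exists_perm_extend s
      rw [← hs', hp.1 s', h2] at h1
      have h3 : ∏ l, ((x ∘ s) l - q * t) = ∏ l, (x l - q * t) :=
        Equiv.prod_comp s (fun l => x l - q * t)
      rw [h3] at h1 hne
      rw [one_mul]
      exact (mul_left_cancel₀ hne h1).symm
  · intro x i j l hij hjl hil hj hl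
    have := coeff_eq_of_generic r x x 0 ?_ k
    · simpa using this
    · intro t ht
      have hne : ∏ l, (x l - q * t) ≠ 0 := Finset.prod_ne_zero_iff.2 fun l _ => ht l
      have h1 := eval_factor hr t x
      rw [hp.2 _ i.succ.succ j.succ.succ l.succ.succ (by simpa using hij) (by simpa using hjl)
        (by simpa using hil) (by simpa using hj) (by simpa using hl)] at h1
      rw [zero_mul]
      exact (mul_eq_zero.1 h1.symm).resolve_left hne

theorem coeff_degree {m : ℕ} {p : MvPolynomial (Fin (m + 2)) ℂ}
    {r : MvPolynomial (Fin (m + 1)) ℂ} (hr : phi m p = bigPi m * r) (k : ℕ)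
    (hk : (finSuccEquiv ℂ m r).coeff k ≠ 0) :
    ((finSuccEquiv ℂ m r).coeff k).totalDegree + k + m ≤ p.totalDegree := by
  have hr0 : r ≠ 0 := by
    rintro rfl
    simp at hk
  have h1 := totalDegree_coeff_finSuccEquiv_add_le r k hk
  have h2 := phi_totalDegree m p
  rw [hr, totalDegree_mul_of_isDomain (bigPi_ne_zero m) hr0,
    (bigPi_homog m).totalDegree (bigPi_ne_zero m)] at h2
  omega

/-- Kernel of `phi` on low degree symmetric polynomials. -/
theorem phi_kernel {m : ℕ} {p : MvPolynomial (Fin (m + 2)) ℂ} (hp : SW p) (h0 : phi m p = 0)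
    (hd : p.totalDegree < (m + 2) * (m + 1)) : p = 0 := by
  by_contra hne
  have hdvd : ∏ e ∈ (Finset.univ : Finset (Fin (m + 2))).offDiag, lin (q ^ 2) e.1 e.2 ∣ p := by
    apply Finset.prod_dvd_of_isRelPrime
    · rintro ⟨i, j⟩ hij ⟨k, l⟩ hkl hne
      simp only [Finset.coe_offDiag, Finset.coe_univ, Set.mem_offDiag, Set.mem_univ,
        true_and] at hij hkl
      -- a point which kills the first form only
      by_cases hc : k = j ∧ l = i
      · obtain ⟨rfl, rfl⟩ := hc
        apply lin_relPrime _ _ hij hkl (Function.update (fun _ => 1) l (q ^ 2))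
        · simp [hij.symm]
        · simp only [Function.update_self]
          rw [Function.update_of_ne hij.symm]
          intro h
          apply q_ne_one
          have := q_cube
          linear_combination -h - q * this
      · by_cases hk : k = i
        · subst hk
          have hlj : l ≠ j := fun h => hne (by rw [h])
          apply lin_relPrime _ _ hij hkl (Function.update (fun _ => 0) l 1)
          · simp [hlj.symm, hkl]
          · simp only [Function.update_self, Function.update_of_ne hkl, mul_one]
            exact (pow_ne_zero 2 q_ne_zero).symm
        · by_cases hk' : k = j
          · subst hk'
            have hli : l ≠ i := fun h => hc ⟨rfl, h⟩
            apply lin_relPrime _ _ hij hkl (Function.update (fun _ => 0) l 1)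
            · simp [hli.symm, hkl]
            · simp only [Function.update_self, Function.update_of_ne hkl, mul_one]
              exact (pow_ne_zero 2 q_ne_zero).symm
          · apply lin_relPrime _ _ hij hkl (Function.update (fun _ => 0) k 1)
            · simp [Ne.symm hk, Ne.symm hk']
            · simp [hkl.symm]
    · rintro ⟨i, j⟩ hij
      simp only [Finset.mem_offDiag, Finset.mem_univ, true_and] at hij
      rw [lin_dvd_iff _ hij]
      intro x hx
      obtain ⟨s, hs0, hs1⟩ : ∃ s : Equiv.Perm (Fin (m + 2)), s 0 = j ∧ s 1 = i := by
        refine ⟨Equiv.swap (Equiv.swap 0 j 1) i * Equiv.swap 0 j, ?_, ?_⟩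
        · simp only [Equiv.Perm.coe_mul, Function.comp_apply, Equiv.swap_apply_left]
          apply Equiv.swap_apply_of_ne_of_ne _ hij.symm
          intro h
          have h2 := congrArg (Equiv.swap 0 j) h
          simp at h2
        · simp
      rw [← hp.1 s x]
      have hx' : x ∘ s = Fin.cons (x (s 0)) (Fin.cons (q ^ 2 * x (s 0))
          (fun l : Fin m => x (s l.succ.succ))) := by
        funext l
        refine Fin.cases ?_ (fun l => ?_) l
        · simp
        · refine Fin.cases ?_ (fun l => ?_) l
          · simpa [hs0, hs1] using hx
          · simp
      rw [hx', ← eval_phi, h0, map_zero]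
  obtain ⟨g, hg⟩ := hdvd
  have hP : (∏ e ∈ (Finset.univ : Finset (Fin (m + 2))).offDiag,
      lin (q ^ 2) e.1 e.2).IsHomogeneous ((m + 2) * (m + 1)) := by
    have := IsHomogeneous.prod (Finset.univ : Finset (Fin (m + 2))).offDiag
      (fun e => lin (q ^ 2) e.1 e.2) (fun _ => 1) (fun s _ => lin_homog _ _ _)
    convert this using 1
    simp only [Finset.sum_const, Finset.offDiag_card, Finset.card_univ, Fintype.card_fin,
      smul_eq_mul, mul_one]
    rw [← Nat.mul_sub_one]
    rfl
  have hg0 : g ≠ 0 := by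
    rintro rfl
    exact hne (by rw [hg, mul_zero])
  have hP0 : (∏ e ∈ (Finset.univ : Finset (Fin (m + 2))).offDiag, lin (q ^ 2) e.1 e.2) ≠ 0 := by
    intro h
    exact hne (by rw [hg, h, zero_mul])
  rw [hg, totalDegree_mul_of_isDomain hP0 hg0, hP.totalDegree hP0] at hd
  omega

/-- Uniqueness. -/
theorem SW_unique (n : ℕ) :
    (∀ p : MvPolynomial (Fin (2 * n)) ℂ, SW p → p.totalDegree + n < n * n → p = 0) ∧
    (∀ p p' : MvPolynomial (Fin (2 * n)) ℂ, SW p → SW p' → p.totalDegree + n ≤ n * n →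
      p'.totalDegree + n ≤ n * n → ∃ a b : ℂ, (a ≠ 0 ∨ b ≠ 0) ∧ C a * p + C b * p' = 0) := by
  induction n with
  | zero =>
    refine ⟨fun p _ h => by simp at h, ?_⟩
    intro p p' _ _ _ _
    have : IsEmpty (Fin (2 * 0)) := by simpa using Fin.isEmpty
    obtain ⟨a, rfl⟩ := C_surjective (R := ℂ) (Fin (2 * 0)) p
    obtain ⟨b, rfl⟩ := C_surjective (R := ℂ) (Fin (2 * 0)) p'
    by_cases ha : a = 0
    · exact ⟨1, 0, by simp, by simp [ha]⟩
    · refine ⟨b, -a, by simp [ha], ?_⟩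
      rw [← C_mul, ← C_mul, ← C_add, ← C_0]
      congr 1
      ring
  | succ n ih =>
    obtain ⟨ih1, ih2⟩ := ih
    have e1 : (n + 1) * (n + 1) = n * n + 2 * n + 1 := by ring
    have e2 : (2 * n + 2) * (2 * n + 1) = 4 * (n * n) + 6 * n + 2 := by ring
    constructor
    · intro p hp hd
      change MvPolynomial (Fin (2 * n + 2)) ℂ at p
      obtain ⟨r, hr⟩ := phi_factor (m := 2 * n) hp
      have hr0 : r = 0 := by
        apply (finSuccEquiv ℂ (2 * n)).injective
        rw [map_zero]
        ext1 k
        rw [Polynomial.coeff_zero]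
        by_contra hk
        have h1 := coeff_degree hr k hk
        exact hk (ih1 _ (coeff_SW hp hr k) (by omega))
      rw [hr0, mul_zero] at hr
      exact phi_kernel hp hr (by omega)
    · intro p p' hp hp' hd hd'
      change MvPolynomial (Fin (2 * n + 2)) ℂ at p p'
      obtain ⟨r, hr⟩ := phi_factor (m := 2 * n) hp
      obtain ⟨r', hr'⟩ := phi_factor (m := 2 * n) hp'
      have main : ∀ (p : MvPolynomial (Fin (2 * n + 2)) ℂ) (_ : SW p)
          (_ : p.totalDegree + (n + 1) ≤ (n + 1) * (n + 1))
          (r : MvPolynomial (Fin (2 * n + 1)) ℂ) (_ : phi (2 * n) p = bigPi (2 * n) * r),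
          ((finSuccEquiv ℂ (2 * n) r).coeff 0).totalDegree + n ≤ n * n ∧
          ∀ k, k ≠ 0 → (finSuccEquiv ℂ (2 * n) r).coeff k = 0 := by
        intro p hp hd r hr
        constructor
        · by_cases h0 : (finSuccEquiv ℂ (2 * n) r).coeff 0 = 0
          · rw [h0]
            have : n ≤ n * n := Nat.le_mul_self n
            simpa using this
          · have := coeff_degree hr 0 h0
            omega
        · intro k hk0
          by_contra hk
          have h1 := coeff_degree hr k hk
          exact hk (ih1 _ (coeff_SW hp hr k) (by omega))
      obtain ⟨m1, m2⟩ := main p hp hd r hr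
      obtain ⟨m1', m2'⟩ := main p' hp' hd' r' hr'
      obtain ⟨a, b, hab, hz⟩ := ih2 _ _ (coeff_SW hp hr 0) (coeff_SW hp' hr' 0) m1 m1'
      refine ⟨a, b, hab, ?_⟩
      have hrr : C a * r + C b * r' = 0 := by
        apply (finSuccEquiv ℂ (2 * n)).injective
        rw [map_zero, map_add, map_mul, map_mul]
        have hC : ∀ c : ℂ, finSuccEquiv ℂ (2 * n) (C c) = Polynomial.C (C c) := by
          intro c
          have := RingHom.congr_fun (finSuccEquiv_comp_C_eq_C (R := ℂ) (2 * n)) c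
          rw [← (finSuccEquiv ℂ (2 * n)).symm_apply_eq.1 (by simpa using this)]
        rw [hC, hC]
        ext1 k
        rw [Polynomial.coeff_add, Polynomial.coeff_C_mul, Polynomial.coeff_C_mul,
          Polynomial.coeff_zero]
        by_cases hk : k = 0
        · subst hk
          exact hz
        · rw [m2 k hk, m2' k hk]
          simp
      apply phi_kernel (m := 2 * n) (hp.comb hp' a b)
      · have hC : ∀ c : ℂ, phi (2 * n) (C c) = C c := fun c => by simp [phi]
        rw [map_add, map_mul, map_mul, hC, hC, hr, hr']
        linear_combination bigPi (2 * n) * hrr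
      · have h1 := totalDegree_add (C a * p) (C b * p')
        have h2 := totalDegree_mul (C a) p
        have h3 := totalDegree_mul (C b) p'
        rw [totalDegree_C] at h2 h3
        have : max (C a * p).totalDegree (C b * p').totalDegree ≤ n * n + n := by
          apply max_le <;> omega
        have h4 : totalDegree (C a * p + C b * p') ≤ n * n + n := h1.trans this
        omega

/-! ### Existence -/

/-- The alternant with exponents `e`. -/
noncomputable def alt {N : ℕ} (e : Fin N → ℕ) : MvPolynomial (Fin N) ℂ :=
  (Matrix.of fun i j : Fin N => (X i : MvPolynomial (Fin N) ℂ) ^ e j).det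

theorem eval_alt {N : ℕ} (e : Fin N → ℕ) (x : Fin N → ℂ) :
    eval x (alt e) = (Matrix.of fun i j : Fin N => x i ^ e j).det := by
  unfold alt
  rw [RingHom.map_det]
  congr 1
  ext i j
  simp

theorem eval_alt_perm {N : ℕ} (e : Fin N → ℕ) (x : Fin N → ℂ) (s : Equiv.Perm (Fin N)) :
    eval (x ∘ s) (alt e) = (Equiv.Perm.sign s : ℤ) * eval x (alt e) := by
  rw [eval_alt, eval_alt, ← Matrix.det_permute]
  rfl

theorem alt_homog {N : ℕ} (e : Fin N → ℕ) : (alt e).IsHomogeneous (∑ j, e j) := by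
  unfold alt
  rw [Matrix.det_apply]
  apply IsHomogeneous.sum
  intro s _
  have h : (∏ i, (Matrix.of fun i j : Fin N => (X i : MvPolynomial (Fin N) ℂ) ^ e j)
      (s i) i).IsHomogeneous (∑ j, e j) := by
    apply IsHomogeneous.prod
    intro i _
    exact isHomogeneous_X_pow _ _
  rcases Int.units_eq_one_or (Equiv.Perm.sign s) with h1 | h1
  · rw [h1, one_smul]; exact h
  · rw [h1, Units.neg_smul, one_smul]; exact h.neg

theorem alt_val {N : ℕ} :
    (alt (fun j : Fin N => (j : ℕ))) = ∏ i : Fin N, ∏ j ∈ Finset.Ioi i, lin 1 j i := by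
  unfold alt
  have := Matrix.det_vandermonde (fun i : Fin N => (X i : MvPolynomial (Fin N) ℂ))
  unfold Matrix.vandermonde at this
  rw [this]
  simp [lin]

theorem eval_vand_ne_zero {N : ℕ} (x : Fin N → ℂ) (hx : Function.Injective x) :
    eval x (alt (fun j : Fin N => (j : ℕ))) ≠ 0 := by
  rw [eval_alt]
  exact Matrix.det_vandermonde_ne_zero_iff.2 hx

theorem alt_ne_zero {N : ℕ} (e : Fin N → ℕ) (he : Function.Injective e) : alt e ≠ 0 := by
  intro h
  have h1 := eval_alt e (fun i => (2 : ℂ) ^ (i : ℕ))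
  rw [h, map_zero, ← Matrix.det_transpose] at h1
  have h2 : (Matrix.vandermonde fun j : Fin N => (2 : ℂ) ^ e j).det ≠ 0 := by
    apply Matrix.det_vandermonde_ne_zero_iff.2
    intro i j hij
    apply he
    have hij' : (2 : ℂ) ^ e i = (2 : ℂ) ^ e j := hij
    have : (2 : ℕ) ^ e i = 2 ^ e j := by exact_mod_cast hij'
    exact Nat.pow_right_injective le_rfl this
  apply h2
  rw [h1]
  congr 1
  ext i j
  simp only [Matrix.vandermonde_apply, Matrix.transpose_apply, Matrix.of_apply]
  rw [← pow_mul, ← pow_mul, mul_comm]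

theorem vand_dvd_alt {N : ℕ} (e : Fin N → ℕ) : alt (fun j : Fin N => (j : ℕ)) ∣ alt e := by
  rw [alt_val, Finset.prod_sigma']
  apply Finset.prod_dvd_of_isRelPrime
  · rintro ⟨i, j⟩ hij ⟨k, l⟩ hkl hne
    simp only [Finset.coe_sigma, Set.mem_sigma_iff, Finset.coe_univ, Set.mem_univ, true_and,
      Finset.coe_Ioi, Set.mem_Ioi] at hij hkl
    by_cases hc : k = i ∨ k = j
    · have hl : l ≠ i ∧ l ≠ j := by
        rcases hc with rfl | rfl
        · exact ⟨hkl.ne', fun h => hne (by rw [h])⟩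
        · exact ⟨(hij.trans hkl).ne', hkl.ne'⟩
      apply lin_relPrime _ _ hij.ne' hkl.ne' (Function.update (fun _ => 0) l 1)
      · simp [hl.1.symm, hl.2.symm]
      · simp [hkl.ne]
    · push Not at hc
      apply lin_relPrime _ _ hij.ne' hkl.ne' (Function.update (fun _ => 0) k 1)
      · simp [hc.1.symm, hc.2.symm]
      · simp [hkl.ne']
  · rintro ⟨i, j⟩ hij
    simp only [Finset.mem_sigma, Finset.mem_univ, true_and, Finset.mem_Ioi] at hij
    rw [lin_dvd_iff _ hij.ne']
    intro x hx
    rw [eval_alt]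
    apply Matrix.det_zero_of_row_eq hij.ne'
    funext l
    simp only [one_mul] at hx
    simp [hx]

/-- The exponents `0, 1, 3, 4, 6, 7, …`. -/
def ex (N : ℕ) (j : Fin N) : ℕ := 3 * ((j : ℕ) / 2) + (j : ℕ) % 2

theorem ex_inj (N : ℕ) : Function.Injective (ex N) := by
  intro i j h
  unfold ex at h
  ext
  omega

theorem ex_sum (n : ℕ) : ∑ j, ex (2 * n) j = n * (n - 1) + ∑ j : Fin (2 * n), (j : ℕ) := by
  have h1 : ∑ j, ex (2 * n) j = ∑ j ∈ Finset.range (2 * n), (3 * (j / 2) + j % 2) :=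
    Fin.sum_univ_eq_sum_range (fun j => 3 * (j / 2) + j % 2) (2 * n)
  have h2 : ∑ j : Fin (2 * n), (j : ℕ) = ∑ j ∈ Finset.range (2 * n), j :=
    Fin.sum_univ_eq_sum_range (fun j => j) (2 * n)
  rw [h1, h2]
  clear h1 h2
  induction n with
  | zero => simp
  | succ n ih =>
    rw [show 2 * (n + 1) = 2 * n + 1 + 1 by ring]
    rw [Finset.sum_range_succ, Finset.sum_range_succ, ih, Finset.sum_range_succ,
      Finset.sum_range_succ]
    have e1 : (2 * n + 1) / 2 = n := by omega
    have e2 : (2 * n) / 2 = n := by omega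
    have e3 : (2 * n + 1) % 2 = 1 := by omega
    have e4 : (2 * n) % 2 = 0 := by omega
    rw [e1, e2, e3, e4]
    have e5 : (n + 1) * (n + 1 - 1) = n * (n - 1) + 2 * n := by
      cases n with
      | zero => simp
      | succ k => simp only [Nat.add_sub_cancel]; ring
    rw [e5]
    ring

theorem eval_alt_wheel {N : ℕ} (x : Fin N → ℂ) (i j k : Fin N) (hij : i ≠ j)
    (hik : i ≠ k) (hj : x j = q ^ 2 * x i) (hk : x k = q ^ 4 * x i) :
    eval x (alt (ex N)) = 0 := by
  rw [eval_alt]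
  apply Matrix.exists_vecMul_eq_zero_iff.1
  refine ⟨Pi.single i 1 + Pi.single j (q ^ 2) + Pi.single k q, ?_, ?_⟩
  · intro h
    have := congrFun h i
    simp [hij, hik] at this
  · rw [Matrix.add_vecMul, Matrix.add_vecMul, Matrix.single_vecMul, Matrix.single_vecMul,
      Matrix.single_vecMul]
    funext l
    simp only [Pi.add_apply, Pi.smul_apply, Matrix.row_apply, Matrix.of_apply, smul_eq_mul,
      Pi.zero_apply, hj, hk, q_four, mul_pow]
    have hq : ∀ a b : ℕ, q ^ (3 * a + b) = q ^ b := by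
      intro a b
      rw [pow_add, pow_mul, q_cube, one_pow, one_mul]
    have h3 := q_cube
    have hs := q_sum
    rw [← pow_mul, mul_comm 2, pow_mul]
    unfold ex
    rw [hq]
    rcases Nat.mod_two_eq_zero_or_one (l : ℕ) with h | h
    · rw [h]
      simp only [pow_zero, one_pow]
      linear_combination (x i ^ (3 * ((l : ℕ) / 2) + 0)) * hs
    · rw [h]
      simp only [pow_one]
      linear_combination (x i ^ (3 * ((l : ℕ) / 2) + 1)) * (hs + q * h3)

theorem eval_wheel_sub {N : ℕ} (p : MvPolynomial (Fin N) ℂ) (i j k : Fin N) (x : Fin N → ℂ) :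
    eval x ((aeval fun l : Fin N =>
      if l = j then C (q ^ 2) * X i
      else if l = k then C (q ^ 4) * X i
      else (X l : MvPolynomial (Fin N) ℂ)) p) =
    eval (fun l => if l = j then q ^ 2 * x i else if l = k then q ^ 4 * x i else x l) p := by
  rw [← MvPolynomial.coe_aeval_eq_eval, ← MvPolynomial.coe_aeval_eq_eval]
  simp only [RingHom.coe_coe]
  rw [← AlgHom.comp_apply, MvPolynomial.comp_aeval]
  congr 1
  congr 1
  funext l
  split_ifs <;> simp

theorem vand_sub_ne_zero {N : ℕ} (i j k : Fin N) (hij : i < j) (hjk : j < k) :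
    (aeval fun l : Fin N =>
      if l = j then C (q ^ 2) * X i
      else if l = k then C (q ^ 4) * X i
      else (X l : MvPolynomial (Fin N) ℂ)) (alt (fun j : Fin N => (j : ℕ))) ≠ 0 := by
  intro h0
  have h1 := eval_wheel_sub (alt (fun j : Fin N => (j : ℕ))) i j k
    (fun l => ((l : ℕ) + 1 : ℂ))
  rw [h0, map_zero] at h1
  refine eval_vand_ne_zero _ ?_ h1.symm
  have hinj : ∀ a b : Fin N, (((a : ℕ) : ℂ) + 1) ^ 3 = (((b : ℕ) : ℂ) + 1) ^ 3 → a = b := by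
    intro a b hab
    have h2 : ((a : ℕ) + 1) ^ 3 = ((b : ℕ) + 1) ^ 3 := by exact_mod_cast hab
    have h3 := Nat.pow_left_injective (n := 3) (by norm_num) h2
    ext
    simpa using h3
  have hne : (((i : ℕ) : ℂ) + 1) ≠ 0 := by exact_mod_cast Nat.succ_ne_zero (i : ℕ)
  have c1 : (q ^ 2) ^ 3 = 1 := by rw [← pow_mul, mul_comm, pow_mul, q_cube, one_pow]
  have c2 := q_cube
  have hqq : q ^ 2 ≠ q := by
    intro h
    apply q_ne_one
    have : q * (q - 1) = 0 := by linear_combination h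
    rcases mul_eq_zero.1 this with h | h
    · exact absurd h q_ne_zero
    · exact sub_eq_zero.1 h
  -- the underlying real index is determined by the cube
  have hcube : ∀ a : Fin N, (if a = j then q ^ 2 * (((i : ℕ) : ℂ) + 1) else if a = k then
      q ^ 4 * (((i : ℕ) : ℂ) + 1) else (((a : ℕ) : ℂ) + 1)) ^ 3 =
      ((((if a = j then i else if a = k then i else a) : Fin N) : ℕ) + 1 : ℂ) ^ 3 := by
    intro a
    rw [q_four]
    split_ifs
    · rw [mul_pow, c1, one_mul]
    · rw [mul_pow, c2, one_mul]
    · rfl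
  intro a b hab
  have hab3 := congrArg (· ^ 3) hab
  simp only [hcube] at hab3
  have hab4 := hinj _ _ hab3
  simp only [q_four] at hab
  have ei : i ≠ j := hij.ne
  have ek : i ≠ k := (hij.trans hjk).ne
  have cancel : ∀ u v : ℂ, u ≠ v → u * (((i : ℕ) : ℂ) + 1) ≠ v * (((i : ℕ) : ℂ) + 1) :=
    fun u v huv h => huv (mul_right_cancel₀ hne h)
  have d1 := cancel _ _ hqq
  have d2 := cancel _ _ q_sq_ne_one
  have d3 := cancel _ _ q_ne_one
  rw [one_mul] at d2 d3
  have ekj : k ≠ j := hjk.ne'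
  clear hab3 hcube cancel h0 h1 hinj
  by_cases haj : a = j
  · subst haj
    by_cases hbj : b = a
    · exact hbj.symm
    · by_cases hbk : b = k
      · subst hbk
        rw [if_pos rfl, if_neg hbj, if_pos rfl] at hab
        exact absurd hab d1
      · rw [if_pos rfl, if_neg hbj, if_neg hbk] at hab hab4
        subst hab4
        exact absurd hab d2
  · by_cases hak : a = k
    · subst hak
      by_cases hbj : b = j
      · subst hbj
        rw [if_pos rfl, if_neg haj, if_pos rfl] at hab
        exact absurd hab.symm d1
      · by_cases hbk : b = a
        · exact hbk.symm
        · rw [if_neg haj, if_pos rfl, if_neg hbj, if_neg hbk] at hab hab4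
          subst hab4
          exact absurd hab d3
    · rw [if_neg haj, if_neg hak] at hab hab4
      by_cases hbj : b = j
      · rw [if_pos hbj] at hab hab4
        subst hab4
        exact absurd hab.symm d2
      · by_cases hbk : b = k
        · rw [if_neg hbj, if_pos hbk] at hab hab4
          subst hab4
          exact absurd hab.symm d3
        · rw [if_neg hbj, if_neg hbk] at hab4
          exact hab4

theorem exists_wheel (n : ℕ) :
    ∃ p : MvPolynomial (Fin (2 * n)) ℂ, p ≠ 0 ∧ IsWheel n p ∧ p.IsSymmetric := by
  obtain ⟨p, hp⟩ := vand_dvd_alt (ex (2 * n))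
  have hA := alt_ne_zero _ (ex_inj (2 * n))
  have hV : alt (fun j : Fin (2 * n) => (j : ℕ)) ≠ 0 := by
    intro h
    rw [hp, h, zero_mul] at hA
    exact hA rfl
  refine ⟨p, ?_, ⟨?_, ?_⟩, ?_⟩
  · rintro rfl
    rw [hp, mul_zero] at hA
    exact hA rfl
  · have hVh := alt_homog (fun j : Fin (2 * n) => (j : ℕ))
    have hAh := alt_homog (ex (2 * n))
    rw [ex_sum, add_comm] at hAh
    letI : GradedAlgebra (homogeneousSubmodule (Fin (2 * n)) ℂ) := MvPolynomial.gradedAlgebra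
    have h1 := DirectSum.coe_decompose_mul_add_of_left_mem (homogeneousSubmodule (Fin (2 * n)) ℂ)
      (i := ∑ j : Fin (2 * n), (j : ℕ)) (j := n * (n - 1)) (b := p) hVh
    rw [← hp, DirectSum.decompose_of_mem_same _ hAh, hp] at h1
    have h2 := mul_left_cancel₀ hV h1
    rw [h2]
    exact (DirectSum.decompose (homogeneousSubmodule (Fin (2 * n)) ℂ) p (n * (n - 1))).2
  · intro i j k hij hjk
    have h1 := congrArg (aeval fun l : Fin (2 * n) =>
      if l = j then C (q ^ 2) * X i
      else if l = k then C (q ^ 4) * X i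
      else (X l : MvPolynomial (Fin (2 * n)) ℂ)) hp
    rw [map_mul] at h1
    refine (mul_eq_zero.1 (h1.symm.trans ?_)).resolve_left (vand_sub_ne_zero i j k hij hjk)
    apply MvPolynomial.funext
    intro x
    rw [eval_wheel_sub, map_zero]
    have hik := hij.trans hjk
    apply eval_alt_wheel _ i j k hij.ne hik.ne
    · simp [hij.ne, hik.ne]
    · simp [hij.ne, hik.ne, hjk.ne']
  · intro s
    apply mul_left_cancel₀ hV
    apply MvPolynomial.funext
    intro x
    rw [map_mul, map_mul, eval_rename]
    have h1 := congrArg (eval (x ∘ s)) hp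
    have h2 := congrArg (eval x) hp
    rw [map_mul, eval_alt_perm, eval_alt_perm] at h1
    rw [map_mul] at h2
    rw [h2] at h1
    have hs : ((Equiv.Perm.sign s : ℤ) : ℂ) ≠ 0 := by
      exact_mod_cast (Equiv.Perm.sign s).ne_zero
    apply mul_left_cancel₀ hs
    linear_combination -h1

theorem SW_of_wheel {n : ℕ} {p : MvPolynomial (Fin (2 * n)) ℂ} (hp : IsWheel n p)
    (hs : p.IsSymmetric) : SW p := by
  have sym : ∀ (s : Equiv.Perm (Fin (2 * n))) (x : Fin (2 * n) → ℂ),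
      eval (x ∘ s) p = eval x p := by
    intro s x
    rw [← eval_rename, hs s]
  refine ⟨sym, ?_⟩
  have base : ∀ (x : Fin (2 * n) → ℂ) (i j k : Fin (2 * n)), i < j → j < k →
      x j = q ^ 2 * x i → x k = q * x i → eval x p = 0 := by
    intro x i j k hij hjk hj hk
    have h1 := eval_wheel_sub p i j k x
    rw [hp.2 i j k hij hjk, map_zero] at h1
    rw [h1]
    congr 2
    funext l
    split_ifs with h h'
    · rw [h, hj]
    · rw [h', hk, q_four]
    · rfl
  have cyc : ∀ (x : Fin (2 * n) → ℂ) (i j k : Fin (2 * n)),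
      (i < j ∧ j < k) ∨ (j < k ∧ k < i) ∨ (k < i ∧ i < j) →
      x j = q ^ 2 * x i → x k = q * x i → eval x p = 0 := by
    intro x i j k h hj hk
    have h3 := q_cube
    rcases h with h | h | h
    · exact base x i j k h.1 h.2 hj hk
    · apply base x j k i h.1 h.2
      · rw [hk, hj]; linear_combination (-q * x i) * h3
      · rw [hj]; linear_combination (- x i) * h3
    · apply base x k i j h.1 h.2
      · rw [hk]; linear_combination (- x i) * h3
      · rw [hk, hj]; ring
  intro x i j k hij hjk hik hj hk
  by_cases h : (i < j ∧ j < k) ∨ (j < k ∧ k < i) ∨ (k < i ∧ i < j)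
  · exact cyc x i j k h hj hk
  · rw [← sym (Equiv.swap j k) x]
    apply cyc _ i k j (by omega)
    · simp [Equiv.swap_apply_of_ne_of_ne hij hik, hj]
    · simp [Equiv.swap_apply_of_ne_of_ne hij hik, hk]

/-- The space of symmetric wheel polynomials. -/
def wheelSpace (n : ℕ) : Submodule ℂ (MvPolynomial (Fin (2 * n)) ℂ) where
  carrier := {p | IsWheel n p ∧ p.IsSymmetric}
  zero_mem' := ⟨⟨isHomogeneous_zero _ _ _, fun _ _ _ _ _ => map_zero _⟩, fun _ => map_zero _⟩
  add_mem' := by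
    rintro a b ⟨⟨ha1, ha2⟩, ha3⟩ ⟨⟨hb1, hb2⟩, hb3⟩
    refine ⟨⟨ha1.add hb1, ?_⟩, ha3.add hb3⟩
    intro i j k hij hjk
    rw [map_add, ha2 i j k hij hjk, hb2 i j k hij hjk, add_zero]
  smul_mem' := by
    rintro c a ⟨⟨ha1, ha2⟩, ha3⟩
    refine ⟨⟨?_, ?_⟩, ha3.smul c⟩
    · rw [smul_eq_C_mul]
      exact ha1.C_mul c
    · intro i j k hij hjk
      rw [map_smul, ha2 i j k hij hjk, smul_zero]

/-- The symmetric wheel polynomials of order `n` form a one-dimensional subspace. -/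
theorem symmetric_wheel_dim_one (n : ℕ) (hn : 1 ≤ n) :
    ∃ W : Submodule ℂ (MvPolynomial (Fin (2 * n)) ℂ),
      (W : Set (MvPolynomial (Fin (2 * n)) ℂ)) =
        {p | IsWheel n p ∧ p.IsSymmetric} ∧
      Module.finrank ℂ W = 1 := by
  refine ⟨wheelSpace n, rfl, ?_⟩
  obtain ⟨p, hp0, hp⟩ := exists_wheel n
  rw [finrank_eq_one_iff_of_nonzero' (⟨p, hp⟩ : wheelSpace n)
    (fun h => hp0 (congrArg Subtype.val h))]
  rintro ⟨w, hw⟩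
  have hw' : IsWheel n w ∧ w.IsSymmetric := hw
  have hdeg : ∀ f : MvPolynomial (Fin (2 * n)) ℂ, IsWheel n f → f.totalDegree + n ≤ n * n := by
    intro f hf
    have h1 := hf.1.totalDegree_le
    have h2 : n * (n - 1) + n = n * n := by
      obtain ⟨k, rfl⟩ : ∃ k, n = k + 1 := ⟨n - 1, by omega⟩
      simp only [Nat.add_sub_cancel]
      ring
    omega
  obtain ⟨a, b, hab, h⟩ := (SW_unique n).2 p w (SW_of_wheel hp.1 hp.2) (SW_of_wheel hw'.1 hw'.2)
    (hdeg p hp.1) (hdeg w hw'.1)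
  have hb : b ≠ 0 := by
    rintro rfl
    rw [C_0, zero_mul, add_zero] at h
    rcases mul_eq_zero.1 h with h | h
    · rw [C_eq_zero] at h
      simp [h] at hab
    · exact hp0 h
  refine ⟨-(b⁻¹ * a), ?_⟩
  apply Subtype.ext
  change (-(b⁻¹ * a)) • p = w
  rw [smul_eq_C_mul]
  have hbb : (C b⁻¹ * C b : MvPolynomial (Fin (2 * n)) ℂ) = 1 := by
    rw [← C_mul, inv_mul_cancel₀ hb, C_1]
  rw [C_neg, C_mul]
  linear_combination (-C b⁻¹) * h + w * hbb
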